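/- Let I be the interpreted system of the SendWaste information exchange E^send under Crash_t, let r be a run of I, m a time, and i an agent nonfailed at (r,m). Then (I,r,m) ⊨ C_N(∃0) ∨ C_N(∃1) if and only if m ≥ min{t+1, n−1} − d_N(r,m), where d_N(r,m) = max over j ∈ N(r,m) of d_j(r,m). -/

import Mathlib

namespace SBA

/-- The set of values `{0,1}`; `false` plays the role of `0`, `true` of `1`. -/
abbrev Values := Bool

/-- Actions of an agent in the SBA problem: decide a value, or do nothing. -/
inductive Action where
  | decide (v : Values)
  | noop
deriving DecidableEq

/-- An adversary: `F m i j = false` means agent `i`'s round-`m` message to `j`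
is not delivered. -/
structure Adversary (n : ℕ) where
  F : ℕ → Fin n → Fin n → Bool

/-- Validity of an adversary for the crash failure model `Crash_t`:
crashes are permanent, an undelivered message means the sender has crashed,
and at most `t` agents are faulty. -/
def Adversary.Valid {n : ℕ} (A : Adversary n) (t : ℕ) : Prop :=
  (∀ m i, A.F m i i = false → ∀ m', m < m' → ∀ k, A.F m' i k = false) ∧
  (∀ m i j, A.F m i j = false → A.F m i i = false) ∧
  {i : Fin n | ∃ m j, A.F m i j = false}.ncard ≤ t

/-- An information exchange: local state types, message types, the special
`crashed` state, a (bijective) choice of initial state for each initial value,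
the message selection function `μ` and the state update function `δ`. -/
structure InfoExchange (n : ℕ) where
  L : Fin n → Type
  M : Fin n → Type
  crashSt : ∀ i, L i
  initSt : ∀ i, Values → L i
  initInj : ∀ i, Function.Injective (initSt i)
  μ : ∀ i, L i → Action → (Fin n → Option (M i))
  δ : ∀ i, L i → Adversary n → Action → ((j : Fin n) → Option (M j)) → L i

/-- A decision protocol for information exchange `E`: each agent maps its
local state to an action. -/
def DecProtocol {n : ℕ} (E : InfoExchange n) := ∀ i : Fin n, E.L i → Action

/-- A run: a (constant) environment state (the adversary) together with, for
each time, a local state for each agent. -/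
structure Run {n : ℕ} (E : InfoExchange n) where
  env : Adversary n
  st : ℕ → (i : Fin n) → E.L i

/-- The vector of messages received by agent `i` in round `k+1`. -/
def recvd {n : ℕ} (E : InfoExchange n) (P : DecProtocol E) (r : Run E) (k : ℕ)
    (i : Fin n) : (j : Fin n) → Option (E.M j) :=
  fun j => if r.env.F (k+1) j i = true
           then E.μ j (r.st k j) (P j (r.st k j)) i else none

/-- Agent `i` has not been crashed by the adversary up to (and including) round `m`. -/
def aliveAt {n : ℕ} (A : Adversary n) (m : ℕ) (i : Fin n) : Prop :=
  ∀ k ≤ m, A.F k i i = true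

instance {n : ℕ} (A : Adversary n) (m : ℕ) (i : Fin n) : Decidable (aliveAt A m i) := by
  unfold aliveAt; infer_instance

/-- `r` is a run generated by decision protocol `P` with information exchange `E`
in the crash failure context `Crash_t`. -/
def IsRun {n : ℕ} (E : InfoExchange n) (P : DecProtocol E) (t : ℕ) (r : Run E) : Prop :=
  r.env.Valid t ∧
  (∀ i, ∃ v, r.st 0 i = E.initSt i v) ∧
  ∀ k i, r.st (k+1) i =
    if aliveAt r.env (k+1) i
    then E.δ i (r.st k i) r.env (P i (r.st k i)) (recvd E P r k i)
    else E.crashSt i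

/-- The interpreted system `I_{P,E,Crash_t}`: the set of runs of `(P,E)` in `Crash_t`. -/
def Runs {n : ℕ} (E : InfoExchange n) (P : DecProtocol E) (t : ℕ) : Set (Run E) :=
  {r | IsRun E P t r}

/-- Agent `i` is nonfailed at the point `(r,m)`, i.e. `i ∈ N(r,m)`. -/
def Nonfailed {n : ℕ} (E : InfoExchange n) (r : Run E) (m : ℕ) (i : Fin n) : Prop :=
  r.st m i ≠ E.crashSt i

/-- (Semantic) formulas: predicates on points. -/
abbrev Form {n : ℕ} (E : InfoExchange n) := Run E → ℕ → Prop

/-- Knowledge: `K_i φ` holds at `(r,m)` iff `φ` holds at every point of the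
system `R` that is indistinguishable to agent `i` from `(r,m)`. -/
def Kn {n : ℕ} (E : InfoExchange n) (R : Set (Run E)) (i : Fin n) (φ : Form E) : Form E :=
  fun r m => ∀ r' ∈ R, ∀ m', r.st m i = r'.st m' i → φ r' m'

/-- `E_N φ`: every nonfailed agent knows `φ`. -/
def EvK {n : ℕ} (E : InfoExchange n) (R : Set (Run E)) (φ : Form E) : Form E :=
  fun r m => ∀ i, Nonfailed E r m i → Kn E R i φ r m

/-- Common knowledge among the nonfailed agents: `E_N^k φ` for all `k ≥ 1`. -/
def CK {n : ℕ} (E : InfoExchange n) (R : Set (Run E)) (φ : Form E) : Form E :=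
  fun r m => ∀ k : ℕ, (EvK E R)^[k+1] φ r m

/-- The atomic proposition `∃v`: some agent has initial value `v` in the run. -/
def ExistsVal {n : ℕ} (E : InfoExchange n) (v : Values) : Form E :=
  fun r _m => ∃ i, r.st 0 i = E.initSt i v

/-- Two runs (of possibly different information exchanges) correspond: same
adversary and the same initial values for all agents. -/
def Corresponds {n : ℕ} (E1 E2 : InfoExchange n) (r1 : Run E1) (r2 : Run E2) : Prop :=
  r1.env = r2.env ∧ ∀ i, ∃ v, r1.st 0 i = E1.initSt i v ∧ r2.st 0 i = E2.initSt i v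

/-- Agreement: nonfailed agents decide the same value. -/
def Agreement {n : ℕ} (E : InfoExchange n) (P : DecProtocol E) (t : ℕ) : Prop :=
  ∀ r ∈ Runs E P t, ∀ (m m' : ℕ) (i j : Fin n) (v v' : Values),
    Nonfailed E r m i → Nonfailed E r m' j →
    P i (r.st m i) = Action.decide v → P j (r.st m' j) = Action.decide v' → v = v'

/-- Validity: any value decided by a nonfailed agent is some agent's initial value. -/
def ValidityP {n : ℕ} (E : InfoExchange n) (P : DecProtocol E) (t : ℕ) : Prop :=
  ∀ r ∈ Runs E P t, ∀ (m : ℕ) (i : Fin n) (v : Values),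
    Nonfailed E r m i → P i (r.st m i) = Action.decide v →
    ∃ j, r.st 0 j = E.initSt j v

/-- Simultaneity: if a nonfailed agent decides in a round, every nonfailed agent
decides in that round. -/
def Simultaneity {n : ℕ} (E : InfoExchange n) (P : DecProtocol E) (t : ℕ) : Prop :=
  ∀ r ∈ Runs E P t, ∀ (m : ℕ) (i j : Fin n) (v : Values),
    Nonfailed E r m i → Nonfailed E r m j →
    P i (r.st m i) = Action.decide v → ∃ w, P j (r.st m j) = Action.decide w

/-- Termination: every agent eventually decides or fails. -/
def TerminationP {n : ℕ} (E : InfoExchange n) (P : DecProtocol E) (t : ℕ) : Prop :=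
  ∀ r ∈ Runs E P t, ∀ i : Fin n,
    (∃ m, ¬ Nonfailed E r m i) ∨ (∃ m v, P i (r.st m i) = Action.decide v)

/-- `(P,E)` is an SBA protocol in the crash failure context `Crash_t`. -/
def IsSBA {n : ℕ} (E : InfoExchange n) (P : DecProtocol E) (t : ℕ) : Prop :=
  Agreement E P t ∧ ValidityP E P t ∧ Simultaneity E P t ∧ TerminationP E P t

/-- `E` does not transmit information about actions. -/
def NoActionInfo {n : ℕ} (E : InfoExchange n) : Prop :=
  ∀ (i : Fin n) (s : E.L i) (a₁ a₂ : Action),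
    E.μ i s a₁ = E.μ i s a₂ ∧ ∀ A v, E.δ i s A a₁ v = E.δ i s A a₂ v

/-- The trivial decision protocol (used to form `I_E` for an information exchange
that does not transmit information about actions). -/
def noopProt {n : ℕ} (E : InfoExchange n) : DecProtocol E := fun _ _ => Action.noop

/-- The interpreted system `I_E` of an information exchange that does not
transmit information about actions. -/
def Sys {n : ℕ} (E : InfoExchange n) (t : ℕ) : Set (Run E) :=
  Runs E (noopProt E) t

end SBA
namespace SBA

/-- Local states of the SendWaste information exchange `E^send`. -/
inductive SendState where
  | crashed
  | live (W : Finset Bool) (h : ℕ) (d : ℕ) (m : ℕ) (v : Bool)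
deriving DecidableEq

/-- The `d` (waste estimate) component of a SendWaste local state. -/
def SendState.dof : SendState → ℕ
  | .crashed => 0
  | .live _ _ d _ _ => d

/-- The SendWaste information exchange `E^send`. -/
def sendE (n : ℕ) : InfoExchange n where
  L := fun _ => SendState
  M := fun _ => Finset Bool × ℕ
  crashSt := fun _ => .crashed
  initSt := fun _ v => .live {v} 0 0 0 v
  initInj := by
    intro i v v' h
    injection h with h1 h2 h3 h4 h5
  μ := fun _ s _ => match s with
    | .crashed => fun _ => none
    | .live W _ d _ _ => fun _ => some (W, d)
  δ := fun _ s _ _ ms => match s with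
    | .crashed => .crashed
    | .live W _ d m v =>
        let h' := (Finset.univ.filter (fun j => (ms j).isNone)).card
        let W' := W ∪ Finset.univ.biUnion (fun j => ((ms j).map Prod.fst).getD ∅)
        let dr := Finset.univ.sup (fun j => ((ms j).map Prod.snd).getD 0)
        .live W' h' (max (max d dr) (h' - (m+1))) (m+1) v

/-- `d_N(r,m)`: the maximum of the waste estimates of the nonfailed agents. -/
noncomputable def dN {n : ℕ} (r : Run (sendE n)) (m : ℕ) : ℕ :=
  letI : ∀ j : Fin n, Decidable (Nonfailed (sendE n) r m j) :=
    fun j => Classical.propDecidable _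
  (Finset.univ.filter (fun j : Fin n => Nonfailed (sendE n) r m j)).sup
    (fun j => SendState.dof (r.st m j))

end SBA

namespace SBA

/-- A delivery pattern: `G k i j` says whether the message sent by `i` to `j` between times `k`
and `k + 1` is delivered. -/
abbrev Pattern (n : ℕ) := ℕ → Fin n → Fin n → Bool

namespace Pattern

variable {n : ℕ}

/-- Agent `i` has not crashed by time `k`. -/
def Alive (G : Pattern n) (k : ℕ) (i : Fin n) : Prop := ∀ p < k, G p i i = true

instance (G : Pattern n) (k : ℕ) (i : Fin n) : Decidable (Alive G k i) := by
  unfold Alive; infer_instance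

/-- The patterns generated by the crash failure model with at most `t` failures. -/
structure Valid (G : Pattern n) (t : ℕ) : Prop where
  perm : ∀ p i, G p i i = false → ∀ q, p < q → ∀ j, G q i j = false
  self : ∀ p i j, G p i j = false → G p i i = false
  card : {i : Fin n | ∃ p, G p i i = false}.ncard ≤ t

/-- The agents that have crashed by time `k`. -/
def dead (G : Pattern n) (k : ℕ) : Finset (Fin n) := Finset.univ.filter fun i => ¬ Alive G k i

/-- The number of messages that `i` misses between times `k` and `k + 1`. -/
def miss (G : Pattern n) (k : ℕ) (i : Fin n) : ℕ :=
  (Finset.univ.filter fun j => G k j i = false).card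

/-- The number of messages missed by `i` in the last round before time `k`. -/
def lastMiss (G : Pattern n) : ℕ → Fin n → ℕ
  | 0, _ => 0
  | k + 1, i => miss G k i

/-- The waste estimate of `i` at time `k`. -/
def waste (G : Pattern n) : ℕ → Fin n → ℕ
  | 0, _ => 0
  | k + 1, i => max (max (waste G k i)
      ((Finset.univ.filter fun j => G k j i = true).sup (waste G k))) (miss G k i - (k + 1))

/-- The set of values seen by `i` up to time `k`. -/
def seen (G : Pattern n) (I : Fin n → Bool) : ℕ → Fin n → Finset Bool
  | 0, i => {I i}
  | k + 1, i => seen G I k i ∪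
      (Finset.univ.filter fun j => G k j i = true).biUnion (seen G I k)

/-! ### Basic properties -/

theorem Alive.mono {G : Pattern n} {k l : ℕ} {i : Fin n} (h : Alive G l i) (hkl : k ≤ l) :
    Alive G k i := fun p hp => h p (hp.trans_le hkl)

theorem alive_succ {G : Pattern n} {k : ℕ} {i : Fin n} :
    Alive G (k + 1) i ↔ Alive G k i ∧ G k i i = true := by
  constructor
  · exact fun h => ⟨h.mono k.le_succ, h k k.lt_succ_self⟩
  · rintro ⟨h, h'⟩ p hp
    rcases Nat.lt_succ_iff_lt_or_eq.mp hp with hp | rfl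
    exacts [h p hp, h']

theorem alive_congr {G H : Pattern n} {k : ℕ} {i : Fin n} (h : ∀ p < k, G p i i = H p i i) :
    Alive G k i ↔ Alive H k i :=
  forall₂_congr fun p hp => by rw [h p hp]

theorem mem_dead {G : Pattern n} {k : ℕ} {i : Fin n} : i ∈ dead G k ↔ ¬ Alive G k i := by
  simp [dead]

theorem dead_mono {G : Pattern n} {k l : ℕ} (h : k ≤ l) : dead G k ⊆ dead G l := by
  intro i
  simp only [mem_dead]
  exact fun hi hl => hi (hl.mono h)

theorem Valid.alive_of_sent {G : Pattern n} {t : ℕ} (hG : Valid G t) {k : ℕ} {i j : Fin n}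
    (h : G k j i = true) : Alive G k j := by
  intro p hp
  by_contra hc
  have := hG.perm p j (by simpa using hc) k hp i
  simp [h] at this

theorem Valid.sent_of_alive {G : Pattern n} {t : ℕ} (hG : Valid G t) {k : ℕ} {i j : Fin n}
    (h : Alive G (k + 1) j) : G k j i = true := by
  by_contra hc
  have := hG.self k j i (by simpa using hc)
  simp [h k k.lt_succ_self] at this

theorem Valid.not_sent {G : Pattern n} {t : ℕ} (hG : Valid G t) {k : ℕ} {i j : Fin n}
    (h : ¬ Alive G k j) : G k j i = false := by
  by_contra hc
  exact h (hG.alive_of_sent (i := i) (by simpa using hc))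

theorem Valid.card_dead_le {G : Pattern n} {t : ℕ} (hG : Valid G t) (k : ℕ) :
    (dead G k).card ≤ t := by
  refine le_trans ?_ hG.card
  rw [← Set.ncard_coe_finset]
  refine Set.ncard_le_ncard ?_ (Set.toFinite _)
  intro i hi
  have hi' : ¬ Alive G k i := mem_dead.mp hi
  simp only [Alive, not_forall] at hi'
  obtain ⟨p, -, hp⟩ := hi'
  exact ⟨p, by simpa using hp⟩

theorem exists_alive_notMem {G : Pattern n} {k : ℕ} (s : Finset (Fin n))
    (h : (dead G k).card + s.card < n) : ∃ i, Alive G k i ∧ i ∉ s := by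
  by_contra! hc
  have : (Finset.univ : Finset (Fin n)) ⊆ dead G k ∪ s := by
    intro i _
    by_cases hi : Alive G k i
    · exact Finset.mem_union_right _ (hc i hi)
    · exact Finset.mem_union_left _ (mem_dead.mpr hi)
  have h1 := Finset.card_le_card this
  have h2 := Finset.card_union_le (dead G k) s
  simp only [Finset.card_univ, Fintype.card_fin] at h1
  omega

theorem Valid.miss_le {G : Pattern n} {t : ℕ} (hG : Valid G t) (k : ℕ) (i : Fin n) :
    miss G k i ≤ (dead G (k + 1)).card := by
  refine Finset.card_le_card fun j hj => ?_
  rw [mem_dead]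
  intro hj'
  have := hG.sent_of_alive (i := i) hj'
  simp [this] at hj

theorem waste_le_succ (G : Pattern n) (k : ℕ) (i : Fin n) : waste G k i ≤ waste G (k + 1) i :=
  (le_max_left _ _).trans (le_max_left _ _)

theorem waste_mono (G : Pattern n) (i : Fin n) : Monotone fun k => waste G k i :=
  monotone_nat_of_le_succ fun k => waste_le_succ G k i

theorem waste_le_of_sent {G : Pattern n} {k : ℕ} {i j : Fin n} (h : G k j i = true) :
    waste G k j ≤ waste G (k + 1) i := by
  refine le_trans ?_ ((le_max_right _ _).trans (le_max_left _ _))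
  exact Finset.le_sup (f := waste G k) (by simpa using h)

theorem miss_le_waste (G : Pattern n) (k : ℕ) (i : Fin n) :
    miss G k i ≤ waste G (k + 1) i + (k + 1) := by
  have : miss G k i - (k + 1) ≤ waste G (k + 1) i := le_max_right _ _
  omega

theorem waste_succ_le {G : Pattern n} {k D : ℕ} {i : Fin n} (h : waste G k i ≤ D)
    (h' : ∀ j, G k j i = true → waste G k j ≤ D) (hm : miss G k i ≤ k + 1 + D) :
    waste G (k + 1) i ≤ D := by
  refine max_le (max_le h (Finset.sup_le fun j hj => h' j (by simpa using hj))) ?_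
  omega

theorem mem_seen_succ {G : Pattern n} {I : Fin n → Bool} {k : ℕ} {i : Fin n} {v : Bool} :
    v ∈ seen G I (k + 1) i ↔ v ∈ seen G I k i ∨ ∃ j, G k j i = true ∧ v ∈ seen G I k j := by
  simp [seen]

theorem init_mem_seen (G : Pattern n) (I : Fin n → Bool) (k : ℕ) (i : Fin n) :
    I i ∈ seen G I k i := by
  induction k with
  | zero => simp [seen]
  | succ k ih => exact mem_seen_succ.mpr (Or.inl ih)

theorem exists_init_of_mem_seen {G : Pattern n} {I : Fin n → Bool} {v : Bool} {k : ℕ} :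
    ∀ {i : Fin n}, v ∈ seen G I k i → ∃ j, I j = v := by
  induction k with
  | zero => exact fun {i} h => ⟨i, by simpa [seen, eq_comm] using h⟩
  | succ k ih =>
    intro i h
    rcases mem_seen_succ.mp h with h | ⟨j, -, h⟩
    exacts [ih h, ih h]

/-! ### Uniformity once the waste is large -/

/-- A round without crashes makes every waste estimate and all seen values common; otherwise
every round up to `k` has used up one of the crashes. -/
theorem Valid.uniform_or_le_card_dead {G : Pattern n} {t : ℕ} (hG : Valid G t)
    (I : Fin n → Bool) (e k : ℕ) :
    (∃ i, Alive G k i ∧ e ≤ waste G k i) →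
      (∀ i j, Alive G k i → Alive G k j → e ≤ waste G k i ∧ seen G I k i = seen G I k j) ∨
        k + e ≤ (dead G k).card := by
  induction k with
  | zero =>
    rintro ⟨i, -, hi⟩
    right
    simp only [waste] at hi
    omega
  | succ k ih =>
    rintro ⟨i, hi, he⟩
    by_cases hm : k + 1 + e ≤ miss G k i
    · exact Or.inr (hm.trans (hG.miss_le k i))
    have hex : ∃ j, Alive G k j ∧ e ≤ waste G k j := by
      by_contra! hc
      rcases Nat.eq_zero_or_pos e with rfl | hpos
      · exact absurd (hc i (hi.mono k.le_succ)) (by omega)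
      have : waste G (k + 1) i ≤ e - 1 := by
        refine waste_succ_le ?_ (fun j hj => ?_) (by omega)
        · have := hc i (hi.mono k.le_succ); omega
        · have := hc j (hG.alive_of_sent hj); omega
      omega
    rcases ih hex with hu | hd
    · left
      have key : ∀ a, Alive G (k + 1) a → seen G I (k + 1) a = seen G I k a := by
        intro a ha
        ext v
        rw [mem_seen_succ]
        refine ⟨?_, Or.inl⟩
        rintro (h | ⟨j, hj, h⟩)
        · exact h
        · rwa [← (hu j a (hG.alive_of_sent hj) (ha.mono k.le_succ)).2]
      intro a b ha hb
      have := hu a b (ha.mono k.le_succ) (hb.mono k.le_succ)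
      exact ⟨this.1.trans (waste_le_succ G k a), by rw [key a ha, key b hb, this.2]⟩
    · by_cases hdd : dead G k = dead G (k + 1)
      · left
        have hal : ∀ a, Alive G k a → Alive G (k + 1) a := by
          intro a ha
          by_contra hc
          rw [← mem_dead, ← hdd, mem_dead] at hc
          exact hc ha
        obtain ⟨j, hj, hje⟩ := hex
        have key : ∀ a, Alive G (k + 1) a → ∀ v,
            v ∈ seen G I (k + 1) a ↔ ∃ b, Alive G k b ∧ v ∈ seen G I k b := by
          intro a ha v
          rw [mem_seen_succ]
          constructor
          · rintro (h | ⟨b, hb, h⟩)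
            exacts [⟨a, ha.mono k.le_succ, h⟩, ⟨b, hG.alive_of_sent hb, h⟩]
          · rintro ⟨b, hb, h⟩
            exact Or.inr ⟨b, hG.sent_of_alive (hal b hb), h⟩
        intro a b ha hb
        refine ⟨hje.trans (waste_le_of_sent (hG.sent_of_alive (hal j hj))), ?_⟩
        ext v
        rw [key a ha, key b hb]
      · right
        have := Finset.card_lt_card ((dead_mono (Nat.le_add_right k 1)).ssubset_of_ne hdd)
        omega

theorem Valid.uniform {G : Pattern n} {t m : ℕ} (hG : Valid G t) (I : Fin n → Bool) {i : Fin n}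
    (hi : Alive G m i) (h : min (t + 1) (n - 1) ≤ m + waste G m i) {j : Fin n}
    (hj : Alive G m j) :
    min (t + 1) (n - 1) ≤ m + waste G m j ∧ seen G I m j = seen G I m i := by
  rcases hG.uniform_or_le_card_dead I (min (t + 1) (n - 1) - m) m ⟨i, hi, by omega⟩ with hu | hd
  · have := hu j i hj hi
    exact ⟨by omega, this.2⟩
  · have hji : j = i := by
      by_contra hne
      have h1 : dead G m ⊆ (Finset.univ.erase i).erase j := by
        intro a ha
        have ha := mem_dead.mp ha
        simp only [Finset.mem_erase, Finset.mem_univ, and_true]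
        exact ⟨fun h => ha (h ▸ hj), fun h => ha (h ▸ hi)⟩
      have h2 := Finset.card_le_card h1
      rw [Finset.card_erase_of_mem (by simp [hne]), Finset.card_erase_of_mem (by simp)] at h2
      simp only [Finset.card_univ, Fintype.card_fin] at h2
      have h3 := hG.card_dead_le m
      have : 1 < n := by
        have := i.2; have := j.2
        have : i.1 ≠ j.1 := fun h => hne (Fin.ext h.symm)
        omega
      omega
    subst hji
    exact ⟨h, rfl⟩

/-! ### Indistinguishability -/

/-- Some agent nonfailed at time `m` has the same local state in both runs. -/
def Link (m : ℕ) (x y : Pattern n × (Fin n → Bool)) : Prop :=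
  ∃ i, Alive x.1 m i ∧ Alive y.1 m i ∧ x.2 i = y.2 i ∧ seen x.1 x.2 m i = seen y.1 y.2 m i ∧
    lastMiss x.1 m i = lastMiss y.1 m i ∧ waste x.1 m i = waste y.1 m i

/-- The equivalence relation of being connected by a chain of indistinguishable runs. -/
def Reach (t m : ℕ) : Pattern n × (Fin n → Bool) → Pattern n × (Fin n → Bool) → Prop :=
  Relation.EqvGen fun x y => Valid x.1 t ∧ Valid y.1 t ∧ Link m x y

/-- No agent that is nonfailed at time `m` has a waste estimate above `D`. -/
def Low (D m : ℕ) (G : Pattern n) : Prop := ∀ i, Alive G m i → waste G m i ≤ D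

theorem Reach.refl {t m : ℕ} (x : Pattern n × (Fin n → Bool)) : Reach t m x x :=
  Relation.EqvGen.refl _

theorem Reach.symm {t m : ℕ} {x y : Pattern n × (Fin n → Bool)} (h : Reach t m x y) :
    Reach t m y x := Relation.EqvGen.symm _ _ h

theorem Reach.trans {t m : ℕ} {x y z : Pattern n × (Fin n → Bool)} (h : Reach t m x y)
    (h' : Reach t m y z) : Reach t m x z := Relation.EqvGen.trans _ _ _ h h'

theorem Reach.low {t m D : ℕ} (hD : m + D + 1 = min (t + 1) (n - 1))
    {x y : Pattern n × (Fin n → Bool)} (h : Reach t m x y) (hx : Low D m x.1) :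
    Low D m y.1 := by
  have key : ∀ G : Pattern n, Valid G t → ∀ i, Alive G m i → waste G m i ≤ D → Low D m G := by
    intro G hG i hi hw j hj
    by_contra hc
    have := (hG.uniform (fun _ => true) hj (by omega) hi).1
    omega
  have : Low D m x.1 ↔ Low D m y.1 := by
    clear hx
    induction h with
    | rel x y h =>
      obtain ⟨hx, hy, i, hi, hi', -, -, -, hw⟩ := h
      exact ⟨fun h => key _ hy i hi' (hw ▸ h i hi), fun h => key _ hx i hi (hw ▸ h i hi')⟩
    | refl => rfl
    | symm _ _ _ ih => exact ih.symm
    | trans _ _ _ _ _ ih ih' => exact ih.trans ih'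
  exact this.mp hx

/-- Local states agree on a set of agents that only hears from agents in the set. -/
theorem agree_of_closed {G H : Pattern n} {I J : Fin n → Bool} (P : ℕ → Fin n → Prop) (q₀ : ℕ)
    (base : ∀ i, P q₀ i → seen G I q₀ i = seen H J q₀ i ∧ lastMiss G q₀ i = lastMiss H q₀ i ∧
      waste G q₀ i = waste H q₀ i)
    (step : ∀ q, q₀ ≤ q → ∀ i, P (q + 1) i →
      P q i ∧ ∀ j, G q j i = H q j i ∧ (G q j i = true → P q j))
    (q : ℕ) (hq : q₀ ≤ q) : ∀ i, P q i → seen G I q i = seen H J q i ∧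
      lastMiss G q i = lastMiss H q i ∧ waste G q i = waste H q i := by
  induction q, hq using Nat.le_induction with
  | base => exact base
  | succ q hq ih =>
    intro i hi
    obtain ⟨hPi, hcol⟩ := step q hq i hi
    have hmiss : miss G q i = miss H q i := by
      simp only [miss, fun j => (hcol j).1]
    have hfilt : (Finset.univ.filter fun j => G q j i = true) =
        Finset.univ.filter fun j => H q j i = true := by
      simp only [fun j => (hcol j).1]
    refine ⟨?_, hmiss, ?_⟩
    · simp only [seen, (ih i hPi).1]
      rw [← hfilt]
      congr 1
      refine Finset.biUnion_congr rfl fun j hj => (ih j ((hcol j).2 ?_)).1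
      simpa using hj
    · simp only [waste, (ih i hPi).2.2, hmiss]
      rw [← hfilt]
      congr 2
      refine Finset.sup_congr rfl fun j hj => (ih j ((hcol j).2 ?_)).2.2
      simpa using hj

theorem agree_of_eq_before {G H : Pattern n} {k : ℕ} (I : Fin n → Bool)
    (h : ∀ p < k, G p = H p) {q : ℕ} (hq : q ≤ k) (i : Fin n) :
    seen G I q i = seen H I q i ∧ lastMiss G q i = lastMiss H q i ∧
      waste G q i = waste H q i := by
  refine agree_of_closed (fun p _ => p ≤ k) 0 ?_ ?_ q q.zero_le i hq
  · intro i _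
    exact ⟨rfl, rfl, rfl⟩
  · intro p _ i hp
    exact ⟨by omega, fun j => ⟨by rw [h p hp], fun _ => by omega⟩⟩

theorem low_of_miss_le {G : Pattern n} {t D m q₀ : ℕ} (hG : Valid G t) (hm : q₀ ≤ m)
    (base : Low D q₀ G)
    (step : ∀ p, q₀ ≤ p → ∀ i, Alive G (p + 1) i → miss G p i ≤ p + 1 + D) : Low D m G := by
  induction m, hm using Nat.le_induction with
  | base => exact base
  | succ p hp ih =>
    intro i hi
    exact waste_succ_le (ih i (hi.mono p.le_succ)) (fun j hj => ih j (hG.alive_of_sent hj))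
      (step p hp i hi)

/-! ### Surgery on patterns -/

/-- Remove all crashes that happen after time `k`. -/
def trunc (G : Pattern n) (k : ℕ) : Pattern n :=
  fun p j i => if p < k then G p j i else decide (Alive G k j)

/-- Agent `b` sends nothing from time `q` on. -/
def silence (G : Pattern n) (b : Fin n) (q : ℕ) : Pattern n :=
  fun p j i => if j = b ∧ q ≤ p then false else G p j i

/-- All messages sent by `a` at time `k` are delivered. -/
def fillRow (G : Pattern n) (k : ℕ) (a : Fin n) : Pattern n :=
  fun p j i => if p = k ∧ j = a then true else G p j i

/-- The message sent by `a` to `b` at time `k` is delivered. -/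
def deliver (G : Pattern n) (k : ℕ) (a b : Fin n) : Pattern n :=
  fun p j i => if p = k ∧ j = a ∧ i = b then true else G p j i

theorem trunc_of_lt {G : Pattern n} {k p : ℕ} (h : p < k) : trunc G k p = G p := by
  funext j i; simp [trunc, h]

theorem trunc_of_le {G : Pattern n} {k p : ℕ} (h : k ≤ p) (j i : Fin n) :
    trunc G k p j i = decide (Alive G k j) := by
  simp [trunc, not_lt.mpr h]

theorem trunc_congr {G H : Pattern n} {k : ℕ} (h : ∀ p < k, G p = H p) :
    trunc G k = trunc H k := by
  funext p j i
  simp only [trunc]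
  split_ifs with hp
  · rw [h p hp]
  · exact decide_eq_decide.mpr (alive_congr fun p hp => by rw [h p hp])

theorem alive_trunc_of_le {G : Pattern n} {k q : ℕ} (h : q ≤ k) {i : Fin n} :
    Alive (trunc G k) q i ↔ Alive G q i :=
  alive_congr fun p hp => by rw [trunc_of_lt (hp.trans_le h)]

theorem alive_trunc_of_ge {G : Pattern n} {k q : ℕ} (h : k ≤ q) {i : Fin n} :
    Alive (trunc G k) q i ↔ Alive G k i := by
  refine ⟨fun h' => (alive_trunc_of_le le_rfl).mp (h'.mono h), fun h' p hp => ?_⟩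
  by_cases hpk : p < k
  · rw [trunc_of_lt hpk]; exact h' p hpk
  · rw [trunc_of_le (not_lt.mp hpk)]; simpa using h'

theorem Valid.trunc {G : Pattern n} {t : ℕ} (hG : Valid G t) (k : ℕ) :
    Valid (trunc G k) t where
  perm p i h q hpq j := by
    have : ∀ r < k, G r i i = false → ¬ Alive G k i := fun r hr h h' => by simp [h' r hr] at h
    by_cases hp : p < k
    · rw [trunc_of_lt hp] at h
      by_cases hq : q < k
      · rw [trunc_of_lt hq]; exact hG.perm p i h q hpq j
      · rw [trunc_of_le (not_lt.mp hq)]; simpa using this p hp h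
    · rw [trunc_of_le (not_lt.mp hp)] at h
      rw [trunc_of_le (by omega)]; exact h
  self p i j h := by
    by_cases hp : p < k
    · rw [trunc_of_lt hp] at h ⊢; exact hG.self p i j h
    · rw [trunc_of_le (not_lt.mp hp)] at h ⊢; exact h
  card := by
    refine le_trans (Set.ncard_le_ncard ?_ (Set.toFinite _)) hG.card
    rintro i ⟨p, hp⟩
    by_cases hpk : p < k
    · rw [trunc_of_lt hpk] at hp; exact ⟨p, hp⟩
    · rw [trunc_of_le (not_lt.mp hpk)] at hp
      have hp := of_decide_eq_false hp
      simp only [Alive, not_forall] at hp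
      obtain ⟨r, -, hr⟩ := hp
      exact ⟨r, by simpa using hr⟩

theorem Valid.fillRow {G : Pattern n} {t : ℕ} (hG : Valid G t) {k : ℕ} {a : Fin n}
    (ha : Alive G k a) : Valid (fillRow G k a) t where
  perm p i h q hpq j := by
    simp only [Pattern.fillRow] at h ⊢
    split_ifs at h with hc
    have := hG.perm p i h q hpq j
    split_ifs with hc'
    · obtain ⟨rfl, rfl⟩ := hc'
      simp [ha p hpq] at h
    · exact this
  self p i j h := by
    simp only [Pattern.fillRow] at h ⊢
    split_ifs at h ⊢ with hc
    exact hG.self p i j h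
  card := by
    refine le_trans (Set.ncard_le_ncard ?_ (Set.toFinite _)) hG.card
    rintro i ⟨p, hp⟩
    simp only [Pattern.fillRow] at hp
    split_ifs at hp
    exact ⟨p, hp⟩

theorem Valid.deliver {G : Pattern n} {t : ℕ} (hG : Valid G t) {k : ℕ} {a b : Fin n}
    (ha : Alive G k a) (hab : a ≠ b) : Valid (deliver G k a b) t where
  perm p i h q hpq j := by
    simp only [Pattern.deliver] at h ⊢
    split_ifs at h with hc
    have := hG.perm p i h q hpq j
    split_ifs with hc'
    · obtain ⟨rfl, rfl, rfl⟩ := hc'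
      simp [ha p hpq] at h
    · exact this
  self p i j h := by
    simp only [Pattern.deliver] at h ⊢
    split_ifs at h with hc
    rw [if_neg]
    · exact hG.self p i j h
    · rintro ⟨-, rfl, h'⟩
      exact hab h'
  card := by
    refine le_trans (Set.ncard_le_ncard ?_ (Set.toFinite _)) hG.card
    rintro i ⟨p, hp⟩
    simp only [Pattern.deliver] at hp
    split_ifs at hp
    exact ⟨p, hp⟩

theorem alive_deliver {G : Pattern n} {k : ℕ} {a b : Fin n} (hab : a ≠ b) {q : ℕ} {i : Fin n} :
    Alive (deliver G k a b) q i ↔ Alive G q i := by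
  refine alive_congr fun _ _ => ?_
  simp only [deliver]
  rw [if_neg]
  rintro ⟨-, rfl, h⟩
  exact hab h

/-- Silencing one more agent after the last crash. -/
theorem Valid.silence {G : Pattern n} {t k : ℕ} (hG : Valid G t) (b : Fin n)
    (hk : ∀ i, Alive G k i → ∀ q, Alive G q i) (hc : (dead G k).card + 1 ≤ t) :
    Valid (silence G b k) t where
  perm p i h q hpq j := by
    simp only [Pattern.silence] at h ⊢
    split_ifs with hc'
    · rfl
    · split_ifs at h with hc
      · exact absurd ⟨hc.1, by omega⟩ hc'
      · exact hG.perm p i h q hpq j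
  self p i j h := by
    simp only [Pattern.silence] at h ⊢
    split_ifs at h ⊢ with hc
    · rfl
    · exact hG.self p i j h
  card := by
    refine le_trans ?_ hc
    refine le_trans (Set.ncard_le_ncard (t := (insert b (dead G k) : Finset (Fin n))) ?_
      (Set.toFinite _)) ?_
    · rintro i ⟨p, hp⟩
      simp only [Finset.coe_insert, Set.mem_insert_iff, Finset.mem_coe, mem_dead]
      by_contra! hcon
      simp only [Pattern.silence, hcon.1, false_and, if_false] at hp
      have := hk i hcon.2 (p + 1) p p.lt_succ_self
      simp [this] at hp
    · rw [Set.ncard_coe_finset]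
      exact Finset.card_insert_le _ _

theorem silence_of_lt {G : Pattern n} {b : Fin n} {q p : ℕ} (h : p < q) :
    silence G b q p = G p := by
  funext j i
  simp only [silence]
  rw [if_neg]
  omega

theorem silence_of_ne {G : Pattern n} {b : Fin n} {q p : ℕ} {j : Fin n} (h : j ≠ b) (i : Fin n) :
    silence G b q p j i = G p j i := by
  simp [silence, h]

theorem alive_silence {G : Pattern n} {b : Fin n} {k q : ℕ} {i : Fin n} (h : i ≠ b) :
    Alive (silence G b k) q i ↔ Alive G q i :=
  alive_congr fun _ _ => silence_of_ne h i

theorem miss_silence_le (G : Pattern n) (b : Fin n) (k p : ℕ) (i : Fin n) :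
    miss (silence G b k) p i ≤ miss G p i + 1 := by
  refine le_trans (Finset.card_le_card (t := insert b (Finset.univ.filter fun j =>
    G p j i = false)) ?_) (Finset.card_insert_le _ _)
  intro j hj
  by_cases hjb : j = b
  · simp [hjb]
  · rw [Finset.mem_filter, silence_of_ne hjb] at hj
    simp [hj.2]

/-! ### Removing the crashes of one round -/

theorem Valid.exists_alive {G : Pattern n} {t : ℕ} (hG : Valid G t) (ht : t < n) (k : ℕ) :
    ∃ i, Alive G k i := by
  obtain ⟨i, hi, -⟩ := exists_alive_notMem (G := G) (k := k) ∅ (by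
    have := hG.card_dead_le k; simp; omega)
  exact ⟨i, hi⟩

theorem reach_of_agree {G H : Pattern n} {t m : ℕ} (I : Fin n → Bool) (hG : Valid G t)
    (hH : Valid H t) {i : Fin n} (hi : Alive G m i) (hi' : Alive H m i)
    (h : seen G I m i = seen H I m i ∧ lastMiss G m i = lastMiss H m i ∧
      waste G m i = waste H m i) : Reach t m (G, I) (H, I) :=
  .rel _ _ ⟨hG, hH, i, hi, hi', rfl, h⟩

theorem Alive.fillRow {G : Pattern n} {k q : ℕ} {a i : Fin n} (h : Alive G q i) :
    Alive (fillRow G k a) q i := by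
  intro p hp
  simp only [Pattern.fillRow]
  split_ifs
  exacts [rfl, h p hp]

theorem Valid.reach_fillRow {G : Pattern n} {t m k : ℕ} (hG : Valid G t) (ht : t < n)
    (I : Fin n → Bool) {a : Fin n} (ha : Alive G k a)
    (hall : ∀ i, Alive G (k + 1) i → G k a i = true) :
    Reach t m (G, I) (Pattern.fillRow G k a, I) := by
  obtain ⟨i, hi⟩ := hG.exists_alive ht m
  refine reach_of_agree I hG (hG.fillRow ha) hi hi.fillRow ?_
  refine agree_of_closed (G := G) (H := G.fillRow k a) (I := I) (J := I)
    (fun q i => q ≤ k ∨ Alive G q i) 0 (fun _ _ => ⟨rfl, rfl, rfl⟩) ?_ m m.zero_le i (Or.inr hi)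
  intro q _ i hq
  refine ⟨hq.imp (by omega) (·.mono q.le_succ), fun j => ⟨?_, fun h => Or.inr (hG.alive_of_sent h)⟩⟩
  simp only [Pattern.fillRow]
  split_ifs with hc
  · obtain ⟨rfl, rfl⟩ := hc
    exact hall i (hq.resolve_left (by omega))
  · rfl

theorem Valid.miss_eq_of_settled {G : Pattern n} {t k : ℕ} (hG : Valid G t)
    (hk : ∀ i, Alive G k i → ∀ q, Alive G q i) {q : ℕ} (hq : k ≤ q) (i : Fin n) :
    miss G q i = (dead G k).card := by
  unfold miss dead
  congr 1
  ext j
  simp only [Finset.mem_filter, Finset.mem_univ, true_and]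
  constructor
  · intro h hj
    simp [hG.sent_of_alive (i := i) (hk j hj (q + 1))] at h
  · exact fun h => hG.not_sent fun hj => h (hj.mono hq)

/-- If all crashes have happened by time `k + 1` and their number is the largest that the waste
bound admits, then one crash can be postponed by a round without anyone noticing. -/
theorem Valid.exists_reach_fillRow {G : Pattern n} {t m k D : ℕ} (hG : Valid G t) (ht : t < n)
    (I : Fin n → Bool) (hk : ∀ i, Alive G (k + 1) i → ∀ q, Alive G q i) (hkm : k + 2 ≤ m)
    (hlow : Low D m G) (hc : (dead G (k + 1)).card = k + 2 + D) :
    ∃ x, Alive G k x ∧ G k x x = false ∧ Reach t m (G, I) (Pattern.fillRow G k x, I) := by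
  have hw : ∀ q ≤ m, ∀ i, Alive G (k + 1) i → waste G q i ≤ D := fun q hq i hi =>
    (waste_mono G i hq).trans (hlow i (hk i hi m))
  obtain ⟨j, hj⟩ := hG.exists_alive ht (k + 1)
  obtain ⟨x, hx, hxj⟩ : ∃ x, ¬ Alive G (k + 1) x ∧ G k x j = true := by
    by_contra! hcon
    have h1 : dead G (k + 1) ⊆ Finset.univ.filter fun x => G k x j = false := by
      intro x hx
      simpa using hcon x (mem_dead.mp hx)
    have h2 : _ ≤ miss G k j := Finset.card_le_card h1
    have h3 := miss_le_waste G k j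
    have h4 := hw (k + 1) (by omega) j hj
    omega
  have hxk := hG.alive_of_sent hxj
  have hxx : G k x x = false := by
    by_contra hcon
    exact hx (alive_succ.mpr ⟨hxk, by simpa using hcon⟩)
  refine ⟨x, hxk, hxx, ?_⟩
  set H := Pattern.fillRow G k x with hHdef
  have hH : Valid H t := hG.fillRow hxk
  have hpre : ∀ p < k, G p = H p := by
    intro p hp
    funext a b
    simp [hHdef, Pattern.fillRow, hp.ne]
  have hpost : ∀ p, p ≠ k → H p = G p := by
    intro p hp
    funext a b
    simp [hHdef, Pattern.fillRow, hp]
  have hrow : ∀ a b, H k a b = true ↔ a = x ∨ G k a b = true := by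
    intro a b
    by_cases hax : a = x <;> simp [hHdef, Pattern.fillRow, hax]
  have hagree : ∀ i, seen G I k i = seen H I k i ∧ lastMiss G k i = lastMiss H k i ∧
      waste G k i = waste H k i := agree_of_eq_before I hpre le_rfl
  have hsent : ∀ a i, G (k + 1) a i = true ↔ Alive G (k + 1) a := fun a i =>
    ⟨fun h => hG.alive_of_sent h, fun h => hG.sent_of_alive (hk a h (k + 2))⟩
  have hmissG : ∀ i, miss G (k + 1) i = k + 2 + D := fun i => by
    rw [hG.miss_eq_of_settled hk le_rfl, hc]
  have hwH : ∀ i, Alive G (k + 1) i → waste H (k + 1) i ≤ D := by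
    intro i hi
    refine waste_succ_le ?_ (fun a ha => ?_) ?_
    · rw [← (hagree i).2.2]; exact hw k (by omega) i hi
    · rw [← (hagree a).2.2]
      rcases (hrow a i).mp ha with rfl | ha
      · exact (waste_le_of_sent hxj).trans (hw (k + 1) (by omega) j hj)
      · exact (waste_le_of_sent ha).trans (hw (k + 1) (by omega) i hi)
    · refine le_trans (Finset.card_le_card (t := Finset.univ.filter fun a => G k a i = false) ?_) ?_
      · intro a ha
        simp only [Finset.mem_filter, Finset.mem_univ, true_and] at ha ⊢
        by_contra hcon
        have := (hrow a i).mpr (Or.inr (by simpa using hcon))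
        simp [this] at ha
      · have h3 : miss G k i ≤ _ := miss_le_waste G k i
        have h4 := hw (k + 1) (by omega) i hi
        unfold miss at h3
        omega
  have hbase : ∀ i, Alive G (k + 1) i → seen G I (k + 2) i = seen H I (k + 2) i ∧
      lastMiss G (k + 2) i = lastMiss H (k + 2) i ∧ waste G (k + 2) i = waste H (k + 2) i := by
    intro i hi
    have hmiss : miss H (k + 1) i = miss G (k + 1) i := by
      unfold miss; rw [hpost (k + 1) (by omega)]
    refine ⟨?_, hmiss.symm, ?_⟩
    · have hGi : ∀ v, v ∈ seen G I (k + 2) i ↔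
          ∃ a, Alive G (k + 1) a ∧ v ∈ seen G I (k + 1) a := by
        intro v
        rw [mem_seen_succ]
        simp only [hsent]
        exact ⟨fun h => h.elim (fun h => ⟨i, hi, h⟩) id, Or.inr⟩
      have hHi : ∀ v, v ∈ seen H I (k + 2) i ↔
          ∃ a, Alive G (k + 1) a ∧ v ∈ seen H I (k + 1) a := by
        intro v
        rw [mem_seen_succ, hpost (k + 1) (by omega)]
        simp only [hsent]
        exact ⟨fun h => h.elim (fun h => ⟨i, hi, h⟩) id, Or.inr⟩
      ext v
      rw [hGi, hHi]
      constructor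
      · rintro ⟨a, ha, hv⟩
        refine ⟨a, ha, ?_⟩
        rw [mem_seen_succ] at hv ⊢
        rcases hv with hv | ⟨b, hb, hv⟩
        · exact Or.inl ((hagree a).1 ▸ hv)
        · exact Or.inr ⟨b, (hrow b a).mpr (Or.inr hb), (hagree b).1 ▸ hv⟩
      · rintro ⟨a, ha, hv⟩
        rw [mem_seen_succ] at hv
        rcases hv with hv | ⟨b, hb, hv⟩
        · exact ⟨a, ha, mem_seen_succ.mpr (Or.inl ((hagree a).1 ▸ hv))⟩
        · rw [← (hagree b).1] at hv
          rcases (hrow b a).mp hb with rfl | hb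
          · exact ⟨j, hj, mem_seen_succ.mpr (Or.inr ⟨b, hxj, hv⟩)⟩
          · exact ⟨a, ha, mem_seen_succ.mpr (Or.inr ⟨b, hb, hv⟩)⟩
    · have hG2 : waste G (k + 2) i ≤ D := hw (k + 2) hkm i hi
      have hH2 : waste H (k + 2) i ≤ D := by
        refine waste_succ_le (hwH i hi) (fun a ha => ?_) (by rw [hmiss, hmissG])
        rw [hpost (k + 1) (by omega)] at ha
        exact hwH a ((hsent a i).mp ha)
      have h1 : miss G (k + 1) i ≤ _ := miss_le_waste G (k + 1) i
      have h2 : miss H (k + 1) i ≤ _ := miss_le_waste H (k + 1) i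
      rw [hmiss] at h2
      rw [hmissG] at h1 h2
      have h1 : k + 2 + D ≤ waste G (k + 2) i + (k + 2) := h1
      have h2 : k + 2 + D ≤ waste H (k + 2) i + (k + 2) := h2
      omega
  refine reach_of_agree I hG hH (hk j hj m) (hk j hj m).fillRow ?_
  refine agree_of_closed (fun _ i => Alive G (k + 1) i) (k + 2) hbase ?_ m hkm j hj
  intro q hq i hi
  refine ⟨hi, fun a => ⟨by rw [hpost q (by omega)], fun h => ?_⟩⟩
  exact (hG.alive_of_sent h).mono (by omega)

/-- Two patterns that differ only in what `b` hears at time `k` cannot be told apart by the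
other agents if `b` does not send afterwards. -/
theorem Valid.reach_deliver {G : Pattern n} {t m k : ℕ} (hG : Valid G t) (I : Fin n → Bool)
    {a b i : Fin n} (ha : Alive G k a) (hab : a ≠ b) (hib : i ≠ b) (hi : Alive G m i)
    (hb : ∀ p, k < p → p < m → ∀ j, G p b j = false) :
    Reach t m (G, I) (Pattern.deliver G k a b, I) := by
  refine reach_of_agree I hG (hG.deliver ha hab) hi ((alive_deliver hab).mpr hi) ?_
  refine agree_of_closed (G := G) (H := G.deliver k a b) (I := I) (J := I)
    (fun q i => q ≤ m ∧ (q ≤ k ∨ i ≠ b)) 0 (fun _ _ => ⟨rfl, rfl, rfl⟩) ?_ m m.zero_le i ⟨le_rfl, Or.inr hib⟩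
  rintro q - i ⟨hqm, hq⟩
  refine ⟨⟨by omega, hq.imp_left (by omega)⟩, fun j => ⟨?_, fun h => ⟨by omega, ?_⟩⟩⟩
  · simp only [Pattern.deliver]
    rw [if_neg]
    rintro ⟨rfl, -, rfl⟩
    exact hq.elim (by omega) fun h => h rfl
  · by_contra! hcon
    obtain ⟨h1, rfl⟩ := hcon
    simp [hb q h1 (by omega) i] at h

/-- All crashes after time `k` can be removed. -/
def Removable (n t m D k : ℕ) (I : Fin n → Bool) : Prop :=
  ∀ G : Pattern n, Valid G t → Low D m G → Reach t m (G, I) (trunc G k, I)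

theorem Valid.exists_reach_deliver {G : Pattern n} {t m k D : ℕ} (hG : Valid G t)
    (I : Fin n → Bool) (hD : m + D + 1 = min (t + 1) (n - 1))
    (hrem : Removable n t m D (k + 1) I)
    (hk : G.trunc (k + 1) = G) (hkm : k + 2 ≤ m)
    (hlow : Low D m G) (hc : (dead G (k + 1)).card ≤ k + 1 + D) {a b : Fin n}
    (ha : Alive G k a) (hab : a ≠ b) :
    ∃ H, Valid H t ∧ Reach t m (G, I) (H, I) ∧
      ∀ p ≤ k, H p = Pattern.deliver G k a b p := by
  have hset : ∀ i, Alive G (k + 1) i → ∀ q, Alive G q i := by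
    intro i hi q
    rcases le_total q (k + 1) with hq | hq
    · exact hi.mono hq
    · rw [← hk]; exact (alive_trunc_of_ge hq).mpr hi
  set S := Pattern.silence G b (k + 1) with hS
  have hSv : Valid S t := hG.silence b hset (by omega)
  have hpre : ∀ p < k + 1, S p = G p := fun p hp => silence_of_lt hp
  have halive : ∀ i, Alive S (k + 1) i ↔ Alive G (k + 1) i := fun i =>
    alive_congr fun p hp => by rw [hpre p hp]
  have hSlow : Low D m S := by
    refine low_of_miss_le hSv (q₀ := k + 1) (by omega) ?_ ?_
    · intro i hi
      rw [halive] at hi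
      rw [(agree_of_eq_before I hpre le_rfl i).2.2]
      exact (waste_mono G i (show k + 1 ≤ m by omega)).trans (hlow i (hset i hi m))
    · intro p hp i _
      have := miss_silence_le G b (k + 1) p i
      rw [hG.miss_eq_of_settled hset hp] at this
      change miss S p i ≤ _ at this
      omega
  have hGS : Reach t m (G, I) (S, I) := by
    have := hrem S hSv hSlow
    rw [trunc_congr hpre, hk] at this
    exact this.symm
  obtain ⟨i, hi, hib⟩ := exists_alive_notMem (G := G) (k := k + 1) {b} (by simp; omega)
  have hib : i ≠ b := by simpa using hib
  have haS : Alive S k a := (alive_congr fun p hp => by rw [hpre p (by omega)]).mpr ha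
  have hSH : Reach t m (S, I) (Pattern.deliver S k a b, I) := by
    refine hSv.reach_deliver I haS hab hib ((alive_silence hib).mpr (hset i hi m)) ?_
    intro p hp _ j
    simp [hS, Pattern.silence, Nat.succ_le_of_lt hp]
  have hHv := hSv.deliver haS hab
  refine ⟨(Pattern.deliver S k a b).trunc (k + 1), hHv.trunc _,
    (hGS.trans hSH).trans (hrem _ hHv ((hGS.trans hSH).low hD hlow)), fun p hp => ?_⟩
  rw [trunc_of_lt (by omega)]
  funext x y
  simp only [Pattern.deliver, hpre p (by omega)]

/-- As long as some agent crashes between times `k` and `k + 1`, one more message of that round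
can be made to arrive. -/
theorem Valid.exists_reach_more {G : Pattern n} {t m k D : ℕ} (hG : Valid G t) (ht : t < n)
    (I : Fin n → Bool) (hD : m + D + 1 = min (t + 1) (n - 1))
    (hrem : Removable n t m D (k + 1) I) (hkm : k + 1 ≤ m) (hlow : Low D m G)
    {a : Fin n} (ha : Alive G k a) (haa : G k a a = false) :
    ∃ H, Valid H t ∧ Reach t m (G, I) (H, I) ∧ (∀ p < k, H p = G p) ∧
      (∀ x y, G k x y = true → H k x y = true) ∧ ∃ x y, G k x y = false ∧ H k x y = true := by
  have hfill : ∀ (G' : Pattern n) (x : Fin n), (∀ p < k + 1, G' p = G p) → G k x x = false →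
      (∀ p < k, Pattern.fillRow G' k x p = G p) ∧
      (∀ y z, G k y z = true → Pattern.fillRow G' k x k y z = true) ∧
      ∃ y z, G k y z = false ∧ Pattern.fillRow G' k x k y z = true := by
    intro G' x hpre hx
    refine ⟨fun p hp => ?_, fun y z h => ?_, x, x, hx, by simp [Pattern.fillRow]⟩
    · funext y z
      simp [Pattern.fillRow, hp.ne, hpre p (by omega)]
    · simp only [Pattern.fillRow, hpre k k.lt_succ_self]
      split_ifs
      exacts [rfl, h]
  by_cases hinv : ∃ x, Alive G k x ∧ G k x x = false ∧ ∀ i, Alive G (k + 1) i → G k x i = true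
  · obtain ⟨x, hx, hxx, hall⟩ := hinv
    exact ⟨_, hG.fillRow hx, hG.reach_fillRow ht I hx hall, hfill G x (fun _ _ => rfl) hxx⟩
  push Not at hinv
  obtain ⟨b, hb, hab⟩ := hinv a ha haa
  have hab : G k a b = false := by simpa using hab
  have hne : a ≠ b := by
    rintro rfl
    simp [hb k k.lt_succ_self] at haa
  have hdel : ∀ (G' H : Pattern n), (∀ p < k + 1, G' p = G p) →
      (∀ p ≤ k, H p = Pattern.deliver G' k a b p) → (∀ p < k, H p = G p) ∧
      (∀ x y, G k x y = true → H k x y = true) ∧ ∃ x y, G k x y = false ∧ H k x y = true := by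
    intro G' H hpre hH
    refine ⟨fun p hp => ?_, fun y z h => ?_, a, b, hab, by simp [hH k le_rfl, Pattern.deliver]⟩
    · rw [hH p hp.le]
      funext y z
      simp [Pattern.deliver, hp.ne, hpre p (by omega)]
    · rw [hH k le_rfl]
      simp only [Pattern.deliver, hpre k k.lt_succ_self]
      split_ifs
      exacts [rfl, h]
  rcases hkm.eq_or_lt with rfl | hkm'
  · obtain ⟨i, hi, hib⟩ : ∃ i, Alive G (k + 1) i ∧ i ≠ b := by
      by_contra! hsole
      have h1 := miss_le_waste G k b
      have h2 := hlow b hb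
      obtain ⟨x, hxb, hx⟩ : ∃ x, x ≠ b ∧ G k x b = true := by
        by_contra! hcon
        have h3 : Finset.univ.erase b ⊆ Finset.univ.filter fun x => G k x b = false := by
          intro x hx
          simpa using hcon x (Finset.ne_of_mem_erase hx)
        have h4 : _ ≤ miss G k b := Finset.card_le_card h3
        rw [Finset.card_erase_of_mem (Finset.mem_univ _), Finset.card_univ,
          Fintype.card_fin] at h4
        omega
      have hxk := hG.alive_of_sent hx
      have hxx : G k x x = false := by
        by_contra hcon
        exact hxb (hsole x (alive_succ.mpr ⟨hxk, by simpa using hcon⟩))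
      obtain ⟨i, hi, hxi⟩ := hinv x hxk hxx
      rw [hsole i hi] at hxi
      exact hxi hx
    exact ⟨_, hG.deliver ha hne, hG.reach_deliver I ha hne hib hi (fun p _ _ => by omega),
      hdel G _ (fun _ _ => rfl) (fun _ _ => rfl)⟩
  · set T := G.trunc (k + 1) with hT
    have hTv : Valid T t := hG.trunc _
    have hGT : Reach t m (G, I) (T, I) := hrem G hG hlow
    have hTlow : Low D m T := hGT.low hD hlow
    have hpre : ∀ p < k + 1, T p = G p := fun p hp => trunc_of_lt hp
    have hTT : T.trunc (k + 1) = T := trunc_congr hpre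
    have hset : ∀ i, Alive T (k + 1) i → ∀ q, Alive T q i := by
      intro i hi q
      rcases le_total q (k + 1) with hq | hq
      · exact hi.mono hq
      · rw [← hTT]; exact (alive_trunc_of_ge hq).mpr hi
    have haT : Alive T k a := (alive_trunc_of_le k.le_succ).mpr ha
    by_cases hc : (dead T (k + 1)).card ≤ k + 1 + D
    · obtain ⟨H, hH, hTH, hpreH⟩ :=
        hTv.exists_reach_deliver I hD hrem hTT hkm' hTlow hc haT hne
      exact ⟨H, hH, hGT.trans hTH, hdel T H hpre hpreH⟩
    · have hc' : (dead T (k + 1)).card = k + 2 + D := by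
        obtain ⟨i, hi⟩ := hTv.exists_alive ht (k + 1)
        have h1 : miss T (k + 1) i ≤ _ := miss_le_waste T (k + 1) i
        rw [hTv.miss_eq_of_settled hset le_rfl] at h1
        have h2 := (waste_mono T i hkm').trans (hTlow i (hset i hi m))
        change waste T (k + 1 + 1) i ≤ D at h2
        omega
      obtain ⟨x, hx, hxx, hTx⟩ := hTv.exists_reach_fillRow ht I hset hkm' hTlow hc'
      rw [hpre k k.lt_succ_self] at hxx
      exact ⟨_, hTv.fillRow hx, hGT.trans hTx, hfill T x hpre hxx⟩

theorem Removable.pred {t m k D : ℕ} (ht : t < n) {I : Fin n → Bool}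
    (hD : m + D + 1 = min (t + 1) (n - 1)) (hrem : Removable n t m D (k + 1) I)
    (hkm : k + 1 ≤ m) : Removable n t m D k I := by
  intro G hG hlow
  induction hμ : (Finset.univ.filter fun x : Fin n × Fin n => G k x.1 x.2 = false).card
    using Nat.strong_induction_on generalizing G with
  | _ μ ih =>
    subst hμ
    by_cases h : ∃ a, Alive G k a ∧ G k a a = false
    · obtain ⟨a, ha, haa⟩ := h
      obtain ⟨H, hH, hGH, hpre, hmore, x, y, hx, hy⟩ :=
        hG.exists_reach_more ht I hD hrem hkm hlow ha haa
      rw [← trunc_congr hpre]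
      refine hGH.trans (ih _ ?_ H hH (hGH.low hD hlow) rfl)
      refine Finset.card_lt_card ⟨fun z hz => ?_, fun hss => ?_⟩
      · simp only [Finset.mem_filter, Finset.mem_univ, true_and] at hz ⊢
        by_contra hcon
        simp [hmore _ _ (by simpa using hcon)] at hz
      · have := @hss (x, y) (by simpa using hx)
        simp [hy] at this
    · push Not at h
      have hal : ∀ a, Alive G (k + 1) a ↔ Alive G k a := fun a =>
        ⟨fun h => h.mono k.le_succ, fun ha => alive_succ.mpr ⟨ha, by simpa using h a ha⟩⟩
      have : trunc G k = trunc G (k + 1) := by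
        funext p j i
        rcases lt_trichotomy p k with hp | rfl | hp
        · rw [trunc_of_lt hp, trunc_of_lt (by omega)]
        · rw [trunc_of_le le_rfl, trunc_of_lt p.lt_succ_self]
          by_cases hj : Alive G p j
          · rw [hG.sent_of_alive ((hal j).mpr hj)]; simpa using hj
          · rw [hG.not_sent hj]; simpa using hj
        · rw [trunc_of_le hp.le, trunc_of_le hp]
          exact decide_eq_decide.mpr (hal j).symm
      rw [this]
      exact hrem G hG hlow

theorem removable {t m D : ℕ} (ht : t < n) (I : Fin n → Bool)
    (hD : m + D + 1 = min (t + 1) (n - 1)) {k : ℕ} (hk : k ≤ m) : Removable n t m D k I := by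
  induction hk using Nat.decreasingInduction with
  | self =>
    intro G hG _
    obtain ⟨i, hi⟩ := hG.exists_alive ht m
    exact reach_of_agree I hG (hG.trunc m) hi ((alive_trunc_of_le le_rfl).mpr hi)
      (agree_of_eq_before I (fun p hp => (trunc_of_lt hp).symm) le_rfl i)
  | of_succ k hk ih => exact ih.pred ht hD hk

/-! ### Changing initial values -/

/-- The pattern without failures. -/
def full (n : ℕ) : Pattern n := fun _ _ _ => true

theorem alive_full (k : ℕ) (i : Fin n) : Alive (full n) k i := fun _ _ => rfl

theorem valid_full (n t : ℕ) : Valid (full n) t where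
  perm p i h := by simp [full] at h
  self p i j h := by simp [full] at h
  card := by simp [full]

theorem trunc_zero (G : Pattern n) : trunc G 0 = full n := by
  funext p j i
  simp [trunc, full, Alive]

theorem reach_full_update {t m D : ℕ} (ht : t < n) (hD : m + D + 1 = min (t + 1) (n - 1))
    (I : Fin n → Bool) (b : Fin n) (v : Bool) :
    Reach t m (full n, I) (full n, Function.update I b v) := by
  obtain ⟨i, -, hib⟩ := exists_alive_notMem (G := full n) (k := 0) {b} (by
    have : dead (full n) 0 = ∅ := by
      ext i; simpa [mem_dead] using alive_full 0 i
    simp [this]; omega)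
  have hib : i ≠ b := by simpa using hib
  have hI : I i = Function.update I b v i := (Function.update_of_ne hib v I).symm
  rcases Nat.eq_zero_or_pos m with rfl | hm
  · refine .rel _ _ ⟨valid_full n t, valid_full n t, i, alive_full 0 i, alive_full 0 i, hI, ?_,
      rfl, rfl⟩
    simp only [seen, ← hI]
  have hdead : dead (full n) 0 = ∅ := by
    ext i; simpa [mem_dead] using alive_full 0 i
  have hset : ∀ i, Alive (full n) 0 i → ∀ q, Alive (full n) q i := fun i _ q => alive_full q i
  set S := silence (full n) b 0 with hS
  have hSv : Valid S t := (valid_full n t).silence b hset (by simp [hdead]; omega)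
  have hSlow : Low D m S := by
    refine low_of_miss_le hSv m.zero_le (fun i _ => Nat.zero_le _) fun p _ i _ => ?_
    have := miss_silence_le (full n) b 0 p i
    rw [(valid_full n t).miss_eq_of_settled hset p.zero_le, hdead] at this
    change miss S p i ≤ _ at this
    simp at this
    omega
  have hfull : ∀ J, Reach t m (S, J) (full n, J) := by
    intro J
    have := removable ht J hD m.zero_le S hSv hSlow
    rwa [trunc_zero] at this
  have hiS : Alive S m i := (alive_silence hib).mpr (alive_full m i)
  refine ((hfull I).symm.trans (.rel _ _ ⟨hSv, hSv, i, hiS, hiS, hI, ?_⟩)).trans (hfull _)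
  refine agree_of_closed (fun _ i => i ≠ b) 0 ?_ ?_ m m.zero_le i hib
  · intro j hj
    refine ⟨?_, rfl, rfl⟩
    simp only [seen, Function.update_of_ne hj]
  · intro q _ j hj
    refine ⟨hj, fun a => ⟨rfl, ?_⟩⟩
    rintro h rfl
    simp [hS, silence] at h

theorem Valid.reach_const {G : Pattern n} {t m D : ℕ} (hG : Valid G t) (ht : t < n)
    (hD : m + D + 1 = min (t + 1) (n - 1)) (hlow : Low D m G) (I : Fin n → Bool) (v : Bool) :
    Reach t m (G, I) (full n, fun _ => v) := by
  have h0 := removable ht I hD m.zero_le G hG hlow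
  rw [trunc_zero] at h0
  have key : ∀ s : Finset (Fin n),
      Reach t m (full n, I) (full n, fun j => if j ∈ s then v else I j) := by
    intro s
    induction s using Finset.induction_on with
    | empty => exact by simpa using Reach.refl _
    | insert b s _ ih =>
      refine ih.trans ?_
      convert reach_full_update ht hD _ b v using 2
      funext j
      by_cases hj : j = b <;> simp [hj]
  simpa using h0.trans (key Finset.univ)

/-! ### Local states of the SendWaste exchange -/

/-- The local state of `i` at time `k` in the run with pattern `G` and initial values `I`. -/
def state (G : Pattern n) (I : Fin n → Bool) (k : ℕ) (i : Fin n) : SendState :=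
  if Alive G k i then .live (seen G I k i) (lastMiss G k i) (waste G k i) k (I i) else .crashed

theorem state_of_alive {G : Pattern n} {I : Fin n → Bool} {k : ℕ} {i : Fin n}
    (h : Alive G k i) :
    state G I k i = .live (seen G I k i) (lastMiss G k i) (waste G k i) k (I i) := if_pos h

theorem state_ne_crashed {G : Pattern n} {I : Fin n → Bool} {k : ℕ} {i : Fin n} :
    state G I k i ≠ .crashed ↔ Alive G k i := by
  unfold state
  split_ifs with h <;> simp [h]

theorem state_eq_state {G H : Pattern n} {I J : Fin n → Bool} {k l : ℕ} {i : Fin n}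
    (h : Alive G k i) :
    state G I k i = state H J l i ↔ k = l ∧ Alive H l i ∧ I i = J i ∧
      seen G I k i = seen H J l i ∧ lastMiss G k i = lastMiss H l i ∧
      waste G k i = waste H l i := by
  rw [state_of_alive h]
  unfold state
  split_ifs with h'
  · simp only [SendState.live.injEq, h', true_and]
    tauto
  · simp [h']

theorem Valid.update_eq_state {G : Pattern n} {t : ℕ} (hG : Valid G t) {I : Fin n → Bool}
    {r : Run (sendE n)} {k : ℕ} (hF : ∀ j i, r.env.F (k + 1) j i = G k j i)
    (hst : ∀ j, r.st k j = state G I k j) {i : Fin n} (hi : Alive G (k + 1) i) :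
    (sendE n).δ i (r.st k i) r.env (noopProt (sendE n) i (r.st k i))
      (recvd (sendE n) (noopProt (sendE n)) r k i) = state G I (k + 1) i := by
  have hrec : recvd (sendE n) (noopProt (sendE n)) r k i =
      fun j => if G k j i = true then some (seen G I k j, waste G k j) else none := by
    funext j
    simp only [recvd, hF]
    split_ifs with h
    · rw [hst, state_of_alive (hG.alive_of_sent h)]
      rfl
    · rfl
  rw [hrec, hst, state_of_alive (hi.mono k.le_succ), state_of_alive hi]
  have h1 : (Finset.univ.filter fun j => (if G k j i = true then
      some (seen G I k j, waste G k j) else none).isNone = true).card = miss G k i := by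
    unfold miss
    congr 1
    ext j
    by_cases h : G k j i = true <;> simp [h]
  have h2 : (Finset.univ.biUnion fun j => ((if G k j i = true then
      some (seen G I k j, waste G k j) else none).map Prod.fst).getD ∅) =
      (Finset.univ.filter fun j => G k j i = true).biUnion (seen G I k) := by
    ext v
    simp only [Finset.mem_biUnion, Finset.mem_univ, Finset.mem_filter, true_and]
    refine exists_congr fun j => ?_
    split_ifs with h <;> simp [h]
  have h3 : (Finset.univ.sup fun j => ((if G k j i = true then
      some (seen G I k j, waste G k j) else none).map Prod.snd).getD 0) =
      (Finset.univ.filter fun j => G k j i = true).sup (waste G k) := by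
    refine le_antisymm (Finset.sup_le fun j _ => ?_) (Finset.sup_le fun j hj => ?_)
    · split_ifs with h
      · exact Finset.le_sup (f := waste G k) (by simpa using h)
      · exact Nat.zero_le _
    · have hj : G k j i = true := by simpa using hj
      refine le_trans ?_ (Finset.le_sup (Finset.mem_univ j))
      simp [hj]
  change SendState.live (_ ∪ Finset.univ.biUnion _) (Finset.card _)
    (max (max _ (Finset.univ.sup _)) (Finset.card _ - _)) _ _ = _
  rw [h1, h2, h3]
  rfl

theorem exists_pattern {t : ℕ} {r : Run (sendE n)} (hr : r ∈ Sys (sendE n) t) :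
    ∃ (G : Pattern n) (I : Fin n → Bool), Valid G t ∧ ∀ k i, r.st k i = state G I k i := by
  obtain ⟨⟨hperm, hself, hcard⟩, hinit, hstep⟩ := hr
  choose I hI using hinit
  have hG : Valid (fun k j i => r.env.F (k + 1) j i) t := by
    refine ⟨fun p i h q hpq j => hperm _ _ h _ (by omega) j, fun p i j h => hself _ _ _ h, ?_⟩
    refine le_trans (Set.ncard_le_ncard ?_ (Set.toFinite _)) hcard
    rintro i ⟨p, hp⟩
    exact ⟨p + 1, i, hp⟩
  refine ⟨_, I, hG, fun k => ?_⟩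
  induction k with
  | zero =>
    intro i
    rw [hI i, state_of_alive (fun p hp => absurd hp p.not_lt_zero)]
    rfl
  | succ k ih =>
    intro i
    rw [hstep]
    split_ifs with hal
    · exact hG.update_eq_state (fun _ _ => rfl) ih fun p hp => hal (p + 1) (by omega)
    · symm
      by_contra hne
      have hne := state_ne_crashed.mp hne
      refine hal fun p hp => ?_
      rcases p with _ | p
      · by_contra h0
        have := hperm 0 i (by simpa using h0) 1 one_pos i
        have h1 := hne 0 k.succ_pos
        simp [this] at h1
      · exact hne p (by omega)

theorem Valid.exists_run {G : Pattern n} {t : ℕ} (hG : Valid G t) (I : Fin n → Bool) :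
    ∃ r ∈ Sys (sendE n) t, ∀ k i, r.st k i = state G I k i := by
  let A : Adversary n := ⟨fun p j i => match p with
    | 0 => true
    | p + 1 => G p j i⟩
  let r : Run (sendE n) := ⟨A, fun k i => state G I k i⟩
  refine ⟨r, ⟨⟨?_, ?_, ?_⟩, fun i => ⟨I i, ?_⟩, fun k i => ?_⟩, fun _ _ => rfl⟩
  · rintro (_ | p) i h (_ | q) hpq j
    · exact absurd hpq (by omega)
    · cases h
    · exact absurd hpq (by omega)
    · exact hG.perm p i h q (by omega) j
  · rintro (_ | p) i j h
    · cases h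
    · exact hG.self p i j h
  · refine le_trans (Set.ncard_le_ncard ?_ (Set.toFinite _)) hG.card
    rintro i ⟨_ | p, j, h⟩
    · cases h
    · exact ⟨p, hG.self p i j h⟩
  · exact state_of_alive fun p hp => absurd hp p.not_lt_zero
  · have halive : aliveAt A (k + 1) i ↔ Alive G (k + 1) i := by
      constructor
      · exact fun h p hp => h (p + 1) (by omega)
      · rintro h (_ | p) hp
        exacts [rfl, h p (by omega)]
    split_ifs with hal
    · exact (hG.update_eq_state (r := r) (fun _ _ => rfl) (fun _ => rfl) (halive.mp hal)).symm
    · exact if_neg fun h => hal (halive.mpr h)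

end Pattern

open Pattern

/-! ### Common knowledge -/

theorem CK.of_indist {n : ℕ} {E : InfoExchange n} {R : Set (Run E)} {φ : Form E} {r r' : Run E}
    {m m' : ℕ} {i : Fin n} (h : CK E R φ r m) (hi : Nonfailed E r m i) (hr' : r' ∈ R)
    (heq : r.st m i = r'.st m' i) : CK E R φ r' m' := by
  intro k
  have := h (k + 1)
  rw [Function.iterate_succ_apply'] at this
  exact this i hi r' hr' m' heq

theorem CK.holds {n : ℕ} {E : InfoExchange n} {R : Set (Run E)} {φ : Form E} {r : Run E} {m : ℕ}
    {i : Fin n} (h : CK E R φ r m) (hi : Nonfailed E r m i) (hr : r ∈ R) : φ r m :=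
  h 0 i hi r hr m rfl

/-- The induction rule for common knowledge. -/
theorem CK.of_invariant {n : ℕ} {E : InfoExchange n} {R : Set (Run E)} {φ ψ : Form E}
    (hφ : ∀ r m, ψ r m → φ r m)
    (hψ : ∀ r m i, ψ r m → Nonfailed E r m i → ∀ r' ∈ R, ∀ m', r.st m i = r'.st m' i → ψ r' m')
    {r : Run E} {m : ℕ} (h : ψ r m) : CK E R φ r m := by
  have key : ∀ (k : ℕ) (r : Run E) (m : ℕ), ψ r m → (EvK E R)^[k] φ r m := by
    intro k
    induction k with
    | zero => exact hφ
    | succ k ih =>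
      intro r m h
      rw [Function.iterate_succ_apply']
      exact fun i hi r' hr' m' heq => ih r' m' (hψ r m i h hi r' hr' m' heq)
  exact fun k => key (k + 1) r m h

theorem CK.of_reach {n t m : ℕ} {φ : Form (sendE n)} {x y : Pattern n × (Fin n → Bool)}
    (h : Reach t m x y) (hx : Valid x.1 t) {r r' : Run (sendE n)}
    (hr' : r' ∈ Sys (sendE n) t) (hst : ∀ k i, r.st k i = state x.1 x.2 k i)
    (hst' : ∀ k i, r'.st k i = state y.1 y.2 k i) (ht : t < n)
    (hck : CK (sendE n) (Sys (sendE n) t) φ r m) : CK (sendE n) (Sys (sendE n) t) φ r' m := by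
  let Q : Pattern n × (Fin n → Bool) → Prop := fun z =>
    ∀ s ∈ Sys (sendE n) t, (∀ k i, s.st k i = state z.1 z.2 k i) →
      CK (sendE n) (Sys (sendE n) t) φ s m
  have hlink : ∀ z w : Pattern n × (Fin n → Bool), Valid z.1 t → Link m z w → Q z → Q w := by
    rintro z w hz ⟨i, hi, hi', heq⟩ hQ s hs hsst
    obtain ⟨s', hs', hsst'⟩ := hz.exists_run z.2
    refine (hQ s' hs' hsst').of_indist (i := i) ?_ hs ?_
    · change s'.st m i ≠ SendState.crashed
      rw [hsst']
      exact state_ne_crashed.mpr hi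
    · rw [hsst', hsst]
      exact (state_eq_state hi).mpr ⟨rfl, hi', heq⟩
  have hsymm : ∀ z w : Pattern n × (Fin n → Bool), Link m z w → Link m w z := by
    rintro z w ⟨i, hi, hi', h1, h2, h3, h4⟩
    exact ⟨i, hi', hi, h1.symm, h2.symm, h3.symm, h4.symm⟩
  have hQ : Q x ↔ Q y := by
    clear hx hst hst'
    induction h with
    | rel z w h => exact ⟨hlink z w h.1 h.2.2, hlink w z h.2.1 (hsymm z w h.2.2)⟩
    | refl => rfl
    | symm _ _ _ ih => exact ih.symm
    | trans _ _ _ _ _ ih ih' => exact ih.trans ih'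
  refine hQ.mp (fun s hs hsst => ?_) r' hr' hst'
  obtain ⟨i, hi⟩ := hx.exists_alive ht m
  refine hck.of_indist (i := i) ?_ hs (by rw [hst, hsst])
  change r.st m i ≠ SendState.crashed
  rw [hst]
  exact state_ne_crashed.mpr hi

theorem le_dN_iff {n : ℕ} {G : Pattern n} {I : Fin n → Bool} {r : Run (sendE n)}
    (hst : ∀ k i, r.st k i = state G I k i) {m e : ℕ} {i : Fin n} (hi : Alive G m i) :
    e ≤ dN r m ↔ ∃ j, Alive G m j ∧ e ≤ waste G m j := by
  have hnf : ∀ j, Nonfailed (sendE n) r m j ↔ Alive G m j := by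
    intro j
    change r.st m j ≠ SendState.crashed ↔ _
    rw [hst]
    exact state_ne_crashed
  have hdof : ∀ j, Alive G m j → SendState.dof (r.st m j) = waste G m j := by
    intro j hj
    rw [hst, state_of_alive hj]
    rfl
  classical
  unfold dN
  constructor
  · intro h
    rcases Nat.eq_zero_or_pos e with rfl | he
    · exact ⟨i, hi, Nat.zero_le _⟩
    · rw [Finset.le_sup_iff (by simpa using he)] at h
      obtain ⟨j, hj, hje⟩ := h
      have hj := (hnf j).mp (Finset.mem_filter.mp hj).2
      exact ⟨j, hj, hdof j hj ▸ hje⟩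
  · rintro ⟨j, hj, hje⟩
    rw [← hdof j hj] at hje
    exact hje.trans (Finset.le_sup (f := fun j => SendState.dof (r.st m j))
      (Finset.mem_filter.mpr ⟨Finset.mem_univ j, (hnf j).mpr hj⟩))

/-- in the interpreted system of SendWaste `E^send` under
`Crash_t`, for a nonfailed agent `i` at `(r,m)`, `C_N(∃0) ∨ C_N(∃1)` holds at
`(r,m)` iff `m ≥ min {t+1, n-1} − d_N(r,m)`. -/
theorem send_common_knowledge_iff
    {n t : ℕ} (ht : t < n) (r : Run (sendE n)) (hr : r ∈ Sys (sendE n) t)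
    (m : ℕ) (i : Fin n) (hi : Nonfailed (sendE n) r m i) :
    (CK (sendE n) (Sys (sendE n) t) (ExistsVal (sendE n) false) r m ∨
     CK (sendE n) (Sys (sendE n) t) (ExistsVal (sendE n) true) r m)
    ↔ min (t+1) (n-1) - dN r m ≤ m := by
  have hnf : ∀ {s : Run (sendE n)} {G : Pattern n} {I : Fin n → Bool} {k : ℕ} {j : Fin n},
      (∀ k i, s.st k i = state G I k i) → (Nonfailed (sendE n) s k j ↔ Alive G k j) := by
    intro s G I k j hst
    change s.st k j ≠ SendState.crashed ↔ _
    rw [hst]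
    exact state_ne_crashed
  obtain ⟨G, I, hG, hst⟩ := exists_pattern hr
  have hiG : Alive G m i := (hnf hst).mp hi
  constructor
  · intro hck
    by_contra hlt
    have hlow : Low (min (t + 1) (n - 1) - 1 - m) m G := by
      intro j hj
      have := (le_dN_iff hst hiG).mpr ⟨j, hj, le_rfl⟩
      omega
    have hD : m + (min (t + 1) (n - 1) - 1 - m) + 1 = min (t + 1) (n - 1) := by omega
    have hno : ∀ v : Bool,
        ¬ CK (sendE n) (Sys (sendE n) t) (ExistsVal (sendE n) v) r m := by
      intro v hck
      obtain ⟨s, hs, hsst⟩ := (valid_full n t).exists_run fun _ => !v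
      have hck' := hck.of_reach (x := (G, I)) (hG.reach_const ht hD hlow I !v) hG hs hst hsst ht
      obtain ⟨j, hj⟩ := hck'.holds ((hnf hsst).mpr (alive_full m i)) hs
      rw [hsst, state_of_alive (alive_full 0 j)] at hj
      have hj : SendState.live _ _ _ _ (!v) = SendState.live _ _ _ _ v := hj
      simp at hj
    exact hck.elim (hno false) (hno true)
  · intro hle
    have hmain : CK (sendE n) (Sys (sendE n) t) (ExistsVal (sendE n) (I i)) r m := by
      refine CK.of_invariant (ψ := fun s k => ∃ (H : Pattern n) (J : Fin n → Bool), Valid H t ∧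
        (∀ k i, s.st k i = state H J k i) ∧ ∃ j, Alive H k j ∧
          min (t + 1) (n - 1) ≤ k + waste H k j ∧ I i ∈ seen H J k j) ?_ ?_ ?_
      · rintro s k ⟨H, J, -, hs, j, -, -, hv⟩
        obtain ⟨a, ha⟩ := exists_init_of_mem_seen hv
        refine ⟨a, ?_⟩
        rw [hs, state_of_alive (fun p hp => absurd hp p.not_lt_zero), ← ha]
        rfl
      · rintro s k a ⟨H, J, hH, hs, j, hj, hw, hv⟩ ha s' hs' k' heq
        obtain ⟨H', J', hH', hst'⟩ := exists_pattern hs'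
        have haH := (hnf hs).mp ha
        rw [hs, hst'] at heq
        obtain ⟨rfl, ha', -, hseen, -, hwaste⟩ := (state_eq_state haH).mp heq
        obtain ⟨hw', hseen'⟩ := hH.uniform J hj hw haH
        refine ⟨H', J', hH', hst', a, ha', hwaste ▸ hw', ?_⟩
        rw [← hseen, hseen']
        exact hv
      · obtain ⟨j, hj, hw⟩ := (le_dN_iff hst hiG).mp (le_refl (dN r m))
        have hw : min (t + 1) (n - 1) ≤ m + waste G m j := by omega
        refine ⟨G, I, hG, hst, j, hj, hw, ?_⟩
        rw [← (hG.uniform I hj hw hiG).2]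
        exact init_mem_seen G I m i
    cases hv : I i <;> rw [hv] at hmain
    exacts [Or.inl hmain, Or.inr hmain]

end SBA
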